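/- Let n ≥ 1, let Γ be a subgroup of SL(2,ℂ), and let v, w ∈ ℂ² be nonzero. Suppose the point [w] ∈ ℙ(ℂ²) is a limit point of the Γ-orbit of [v]: there exist pairwise distinct elements A_k ∈ Γ and scalars c_k ∈ ℂ such that c_k·(A_k·v) → w as k → ∞. Then [Ψₙ(w)] is a limit point of the ϱₙ(Γ)-orbit of [Ψₙ(v)] in ℙ(ℂ^{n+1}): there exist scalars d_k ∈ ℂ such that d_k·(ϱₙ(A_k)·Ψₙ(v)) → Ψₙ(w) as k → ∞. (The Veronese image of the limit set of Γ is contained in the limit set of the Veronese group ϱₙ(Γ).) -/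

import Mathlib

open Matrix Filter Topology

/-- The Veronese lift `Ψₙ : ℂ² → ℂ^{n+1}`, whose `k`-th coordinate at `(x, y)` is
`C(n,k) · x^(n-k) · y^k`. -/
noncomputable def veronese (n : ℕ) (v : Fin 2 → ℂ) : Fin (n + 1) → ℂ :=
  fun k => (n.choose (k : ℕ) : ℂ) * v 0 ^ (n - (k : ℕ)) * v 1 ^ (k : ℕ)

/-- The matrix `ϱₙ(A)`: the n-th symmetric power of the 2×2 matrix `A` written in the
Veronese basis, given by the explicit entry formula. -/
noncomputable def rho (n : ℕ) (A : Matrix (Fin 2) (Fin 2) ℂ) :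
    Matrix (Fin (n + 1)) (Fin (n + 1)) ℂ :=
  fun m j =>
    ((n.choose (m : ℕ) : ℂ) / (n.choose (j : ℕ) : ℂ)) *
      ∑ l ∈ Finset.Icc ((j : ℕ) - (n - (m : ℕ))) (min (j : ℕ) (m : ℕ)),
        (((n - (m : ℕ)).choose ((j : ℕ) - l) : ℂ) * (((m : ℕ).choose l : ℕ) : ℂ)) *
          A 0 0 ^ (n - (m : ℕ) - ((j : ℕ) - l)) * A 0 1 ^ ((j : ℕ) - l) *
          A 1 0 ^ ((m : ℕ) - l) * A 1 1 ^ l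

/-- The product of two binomial powers, expanded and grouped by the exponent `j` of `y`. -/
lemma sum_choose_mul_choose_eq_mul_pow {R : Type*} [CommSemiring R] (p m : ℕ) (a b c d x y : R) :
    ∑ j ∈ Finset.range (p + m + 1), ∑ l ∈ Finset.Icc (j - p) (min j m),
      ((p.choose (j - l) : R) * (m.choose l : R)) * a ^ (p - (j - l)) * b ^ (j - l) *
        c ^ (m - l) * d ^ l * (x ^ (p + m - j) * y ^ j) =
      (a * x + b * y) ^ p * (c * x + d * y) ^ m := by
  rw [add_comm (a * x), add_comm (c * x), add_pow, add_pow, Finset.sum_mul_sum,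
    Finset.sum_sigma', Finset.sum_sigma']
  refine Finset.sum_nbij' (fun q => ⟨q.1 - q.2, q.2⟩) (fun q => ⟨q.1 + q.2, q.2⟩) ?_ ?_ ?_ ?_ ?_
  · rintro ⟨j, l⟩ h
    simp only [Finset.mem_sigma, Finset.mem_range, Finset.mem_Icc] at h ⊢
    omega
  · rintro ⟨i, l⟩ h
    simp only [Finset.mem_sigma, Finset.mem_range, Finset.mem_Icc] at h ⊢
    omega
  · rintro ⟨j, l⟩ h
    simp only [Finset.mem_sigma, Finset.mem_range, Finset.mem_Icc] at h
    simp only [Sigma.mk.injEq, heq_eq_eq, and_true]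
    omega
  · rintro ⟨i, l⟩ _
    simp
  · rintro ⟨j, l⟩ h
    simp only [Finset.mem_sigma, Finset.mem_range, Finset.mem_Icc] at h ⊢
    obtain ⟨i, rfl⟩ : ∃ i, j = i + l := ⟨j - l, by omega⟩
    have hx : p + m - (i + l) = (p - i) + (m - l) := by omega
    rw [hx, Nat.add_sub_cancel]
    ring

/-- The equivariance `ϱₙ(A) · Ψₙ(v) = Ψₙ(A · v)`. -/
lemma rho_mulVec_veronese (n : ℕ) (A : Matrix (Fin 2) (Fin 2) ℂ) (v : Fin 2 → ℂ) :
    rho n A *ᵥ veronese n v = veronese n (A *ᵥ v) := by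
  funext m
  obtain ⟨p, hp⟩ : ∃ p, n = p + m := ⟨n - m, by omega⟩
  have hnm : n - (m : ℕ) = p := by omega
  have key := sum_choose_mul_choose_eq_mul_pow p m (A 0 0) (A 0 1) (A 1 0) (A 1 1) (v 0) (v 1)
  rw [← hp, ← Fin.sum_univ_eq_sum_range (fun j => ∑ l ∈ Finset.Icc (j - p) (min j m), _)] at key
  simp only [mulVec, dotProduct, veronese, rho, Fin.sum_univ_two, hnm]
  rw [mul_assoc, ← key, Finset.mul_sum]
  refine Finset.sum_congr rfl fun j _ => ?_
  have hj : (n.choose (j : ℕ) : ℂ) ≠ 0 :=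
    Nat.cast_ne_zero.mpr (Nat.choose_pos (Nat.lt_succ_iff.mp j.isLt)).ne'
  rw [← Finset.sum_mul]
  field_simp

/-- The Veronese lift is homogeneous of degree `n`. -/
lemma veronese_smul (n : ℕ) (c : ℂ) (v : Fin 2 → ℂ) :
    veronese n (c • v) = c ^ n • veronese n v := by
  funext k
  have hc : c ^ n = c ^ (n - (k : ℕ)) * c ^ (k : ℕ) := by
    rw [← pow_add, Nat.sub_add_cancel (Nat.lt_succ_iff.mp k.isLt)]
  simp only [veronese, Pi.smul_apply, smul_eq_mul, hc]
  ring

lemma continuous_veronese (n : ℕ) : Continuous (veronese n) := by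
  unfold veronese
  fun_prop

/-- If `[w]` is a limit point of the `Γ`-orbit of `[v]` in `ℙ(ℂ²)`, witnessed by pairwise
distinct elements `A_k ∈ Γ` and scalars `c_k` with `c_k • (A_k · v) → w`, then `[Ψₙ(w)]`
is a limit point of the `ϱₙ(Γ)`-orbit of `[Ψₙ(v)]` in `ℙ(ℂ^{n+1})`. -/
theorem veronese_image_of_limit_point (n : ℕ) (hn : 1 ≤ n)
    (Γ : Subgroup (Matrix.SpecialLinearGroup (Fin 2) ℂ))
    (v w : Fin 2 → ℂ) (hv : v ≠ 0) (hw : w ≠ 0)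
    (A : ℕ → Matrix.SpecialLinearGroup (Fin 2) ℂ)
    (hAΓ : ∀ k, A k ∈ Γ) (hinj : Function.Injective A)
    (c : ℕ → ℂ)
    (hconv : Tendsto (fun k => c k • ((A k : Matrix (Fin 2) (Fin 2) ℂ) *ᵥ v))
      atTop (𝓝 w)) :
    ∃ d : ℕ → ℂ, Tendsto
      (fun k => d k • (rho n (A k : Matrix (Fin 2) (Fin 2) ℂ) *ᵥ veronese n v))
      atTop (𝓝 (veronese n w)) := by
  refine ⟨fun k => c k ^ n, ?_⟩
  simpa only [rho_mulVec_veronese, ← veronese_smul, Function.comp_def] using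
    ((continuous_veronese n).tendsto w).comp hconv
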